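/- Let n ≥ 2, R > 0, and let B = { x ∈ ℝⁿ : |x| < R }. Let a : ℝⁿ → ℝ, f : ℝⁿ → ℝ be smooth functions and α : ℝⁿ → ℝⁿ a smooth vector field, all supported in the closed ball { |x| ≤ R }, and suppose sup_{x} |a(x)| < π / (2R). If for every x ∈ ℝⁿ and every unit vector θ ∈ ℝⁿ one has ∫_{−∞}^{∞} ( f(x + tθ) + ⟨α(x + tθ), θ⟩ ) · exp( ∫₀ᵗ a(x + sθ) ds ) dt = 0, then there exists a smooth function p : ℝⁿ → ℝ with p(x) = 0 for every x with |x| = R, such that f(x) = a(x)·p(x) and α(x) = ∇p(x) for all x ∈ B. -/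

import Mathlib

open RealInnerProductSpace
noncomputable section

section

open MeasureTheory Set Filter Topology

theorem contDiff_integral_zero_one {P : Type*} [NormedAddCommGroup P] [NormedSpace ℝ P]
    {g : P × ℝ → ℝ} (hg : ContDiff ℝ (⊤ : ℕ∞) g) :
    ContDiff ℝ (⊤ : ℕ∞) fun p => ∫ t in (0 : ℝ)..1, g (p, t) := by
  let χ : ContDiffBump (0 : ℝ) := ⟨1, 2, one_pos, one_lt_two⟩
  let G : P → ℝ → ℝ := fun p x => χ x * g (p, -x)
  have hG : ContDiff ℝ (⊤ : ℕ∞) (fun q : P × ℝ => G q.1 q.2) :=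
    (χ.contDiff.comp contDiff_snd).mul (hg.comp (contDiff_fst.prodMk contDiff_snd.neg))
  have hloc : LocallyIntegrable ((Ioc (0 : ℝ) 1).indicator fun _ => (1 : ℝ)) volume :=
    ((integrable_indicator_iff measurableSet_Ioc).2
      (integrableOn_const (by simp) (by simp))).locallyIntegrable
  have hsupp : ∀ p, ∀ x, p ∈ (univ : Set P) → x ∉ Metric.closedBall (0 : ℝ) 2 → G p x = 0 := by
    intro p x _ hx
    have : χ x = 0 := χ.zero_of_le_dist (not_le.1 hx).le
    simp [G, this]
  have key := contDiffOn_convolution_right_with_param_comp (μ := volume) (𝕜 := ℝ)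
    (n := (⊤ : ℕ∞)) (v := fun _ : P => (0 : ℝ)) (ContinuousLinearMap.mul ℝ ℝ) contDiffOn_const
    isOpen_univ (isCompact_closedBall (0 : ℝ) 2) hsupp hloc hG.contDiffOn
  rw [contDiffOn_univ] at key
  convert key using 1
  ext p
  rw [intervalIntegral.integral_of_le zero_le_one, ← integral_indicator measurableSet_Ioc,
    convolution_def]
  refine integral_congr_ae (Eventually.of_forall fun t => ?_)
  by_cases ht : t ∈ Ioc (0 : ℝ) 1
  · have hχ : χ (-t) = 1 := χ.one_of_mem_closedBall (by
      simp only [Metric.mem_closedBall, dist_zero_right, norm_neg, Real.norm_eq_abs, χ]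
      rw [abs_of_pos ht.1]; exact ht.2)
    simp [ht, G, hχ]
  · simp [ht]

theorem contDiff_integral_zero_right {P : Type*} [NormedAddCommGroup P] [NormedSpace ℝ P]
    {g : P × ℝ → ℝ} (hg : ContDiff ℝ (⊤ : ℕ∞) g) :
    ContDiff ℝ (⊤ : ℕ∞) fun q : P × ℝ => ∫ t in (0 : ℝ)..q.2, g (q.1, t) := by
  have h := contDiff_integral_zero_one (P := P × ℝ)
    (g := fun r => r.1.2 * g (r.1.1, r.1.2 * r.2))
    (contDiff_fst.snd.mul (hg.comp (contDiff_fst.fst.prodMk (contDiff_fst.snd.mul contDiff_snd))))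
  convert h using 1
  ext q
  change _ = ∫ t in (0 : ℝ)..1, q.2 * g (q.1, q.2 * t)
  rw [intervalIntegral.integral_const_mul]
  simp [intervalIntegral.mul_integral_comp_mul_left (f := fun t => g (q.1, t)) q.2]

theorem contDiff_of_contDiffAt_tsupport {E F : Type*} [NormedAddCommGroup E] [NormedSpace ℝ E]
    [NormedAddCommGroup F] [NormedSpace ℝ F] {n : WithTop ℕ∞} {f : E → F}
    (hf : ∀ x ∈ tsupport f, ContDiffAt ℝ n f x) : ContDiff ℝ n f := by
  rw [contDiff_iff_contDiffAt]
  intro x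
  by_cases hx : x ∈ tsupport f
  · exact hf x hx
  · exact contDiffAt_const.congr_of_eventuallyEq (notMem_tsupport_iff_eventuallyEq.1 hx)

theorem eq_zero_of_le_norm {E F : Type*} [NormedAddCommGroup E] [NormedSpace ℝ E]
    [TopologicalSpace F] [T2Space F] [Zero F] {g : E → F} (hg : Continuous g) {R : ℝ} (hR : R ≠ 0)
    (h : ∀ x, R < ‖x‖ → g x = 0) {x : E} (hx : R ≤ ‖x‖) : g x = 0 := by
  have hcl : closure (Metric.closedBall (0 : E) R)ᶜ = (Metric.ball (0 : E) R)ᶜ := by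
    rw [closure_compl, interior_closedBall _ hR]
  have : EqOn g (fun _ => 0) (closure (Metric.closedBall (0 : E) R)ᶜ) :=
    EqOn.closure (fun y hy => h y (by simpa using hy)) hg continuous_const
  exact this (by rw [hcl]; simpa using hx)

variable {E : Type*} [NormedAddCommGroup E] [InnerProductSpace ℝ E]

/-- The attenuated integral of `f + ⟪α, θ⟫` along the part of the line through `x` in the
direction `θ` that starts at `x` and ends in the hyperplane `⟪·, θ⟫ = R`. -/
def attenuatedRay (R : ℝ) (a f : E → ℝ) (α : E → E) (x θ : E) : ℝ :=
  ∫ t in (0 : ℝ)..(R - ⟪x, θ⟫), (f (x + t • θ) + ⟪α (x + t • θ), θ⟫) *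
    Real.exp (∫ s in (0 : ℝ)..t, a (x + s • θ))

theorem contDiff_attenuatedRay (R : ℝ) {a f : E → ℝ} {α : E → E} (ha : ContDiff ℝ (⊤ : ℕ∞) a)
    (hf : ContDiff ℝ (⊤ : ℕ∞) f) (hα : ContDiff ℝ (⊤ : ℕ∞) α) :
    ContDiff ℝ (⊤ : ℕ∞) fun q : E × E => attenuatedRay R a f α q.1 q.2 := by
  have hpt : ContDiff ℝ (⊤ : ℕ∞) fun q : (E × E) × ℝ => q.1.1 + q.2 • q.1.2 :=
    contDiff_fst.fst.add (contDiff_snd.smul contDiff_fst.snd)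
  have hK := contDiff_integral_zero_right (P := E × E) (ha.comp hpt)
  have hI := contDiff_integral_zero_right (P := E × E)
    (((hf.comp hpt).add ((hα.comp hpt).inner ℝ contDiff_fst.snd)).mul hK.exp)
  exact hI.comp (contDiff_id.prodMk
    (contDiff_const.sub (contDiff_fst.inner ℝ contDiff_snd)))

theorem hasDerivAt_attenuatedRay (R : ℝ) {a f : E → ℝ} {α : E → E} (ha : Continuous a)
    (hf : Continuous f) (hα : Continuous α) (x : E) {θ : E} (hθ : ‖θ‖ = 1) :
    HasDerivAt (fun τ : ℝ => attenuatedRay R a f α (x + τ • θ) θ)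
      (-(a x * attenuatedRay R a f α x θ) - f x - ⟪α x, θ⟫) 0 := by
  have hline : Continuous fun t : ℝ => x + t • θ := by fun_prop
  set b : ℝ → ℝ := fun t => a (x + t • θ) with hb
  set F : ℝ → ℝ := fun t => f (x + t • θ) + ⟪α (x + t • θ), θ⟫ with hF
  have hbc : Continuous b := ha.comp hline
  have hFc : Continuous F := (hf.comp hline).add ((hα.comp hline).inner continuous_const)
  set K : ℝ → ℝ := fun t => ∫ s in (0 : ℝ)..t, b s with hK
  have hKd : ∀ t, HasDerivAt K (b t) t := fun t =>
    intervalIntegral.integral_hasDerivAt_right (hbc.intervalIntegrable _ _)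
      (hbc.stronglyMeasurableAtFilter _ _) hbc.continuousAt
  have hKc : Continuous K := continuous_iff_continuousAt.2 fun t => (hKd t).continuousAt
  set h : ℝ → ℝ := fun t => F t * Real.exp (K t) with hh
  have hhc : Continuous h := hFc.mul hKc.rexp
  set c := R - ⟪x, θ⟫ with hc
  have hformula : ∀ τ : ℝ, attenuatedRay R a f α (x + τ • θ) θ =
      Real.exp (-K τ) * ∫ t in τ..c, h t := by
    intro τ
    have hend : R - ⟪x + τ • θ, θ⟫ = c - τ := by
      rw [inner_add_left, inner_smul_left, real_inner_self_eq_norm_sq, hθ]; simp [hc]; ring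
    have hsh : ∀ t : ℝ, x + τ • θ + t • θ = x + (t + τ) • θ := fun t => by
      rw [add_smul]; abel
    unfold attenuatedRay
    rw [hend, ← intervalIntegral.integral_const_mul]
    have hK' : ∀ t, (∫ s in (0 : ℝ)..t, a (x + τ • θ + s • θ)) = K (t + τ) - K τ := by
      intro t
      simp_rw [hsh]
      rw [intervalIntegral.integral_comp_add_right (fun s => b s) τ, zero_add, hK]
      exact (intervalIntegral.integral_interval_sub_left (hbc.intervalIntegrable _ _)
        (hbc.intervalIntegrable _ _)).symm
    simp_rw [hK', hsh]
    rw [intervalIntegral.integral_comp_add_right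
      (fun t => (f (x + t • θ) + ⟪α (x + t • θ), θ⟫) * Real.exp (K t - K τ)) τ, zero_add,
      sub_add_cancel]
    refine intervalIntegral.integral_congr fun t _ => ?_
    simp only [hh, hF, sub_eq_add_neg, Real.exp_add]
    ring
  have hI : HasDerivAt (fun τ => ∫ t in τ..c, h t) (-h 0) 0 :=
    intervalIntegral.integral_hasDerivAt_left (hhc.intervalIntegrable _ _)
      (hhc.stronglyMeasurableAtFilter _ _) hhc.continuousAt
  have hx := hformula 0
  simp only [zero_smul, add_zero] at hx
  have hK0 : K 0 = 0 := by simp [hK]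
  rw [funext hformula, hx]
  refine ((hKd 0).neg.exp.mul hI).congr_deriv ?_
  simp [hK0, hh, hb, hF]
  ring

theorem attenuatedRay_eq_zero {R : ℝ} (hR : 0 ≤ R) {a f : E → ℝ} {α : E → E}
    (hf : ∀ x, R < ‖x‖ → f x = 0) (hα : ∀ x, R < ‖x‖ → α x = 0) {x θ : E} (hθ : ‖θ‖ = 1)
    (hint : (∫ t : ℝ, (f (x + t • θ) + ⟪α (x + t • θ), θ⟫) *
        Real.exp (∫ s in (0 : ℝ)..t, a (x + s • θ))) = 0) (hx : R < ‖x‖) :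
    attenuatedRay R a f α x θ = 0 := by
  have hnorm : ∀ t : ℝ, ‖x + t • θ‖ ^ 2 = ‖x‖ ^ 2 + 2 * t * ⟪x, θ⟫ + t ^ 2 := by
    intro t
    rw [norm_add_sq_real, inner_smul_right, norm_smul, hθ, mul_one, Real.norm_eq_abs, sq_abs]
    ring
  have hinn : ∀ t : ℝ, ⟪x + t • θ, θ⟫ = ⟪x, θ⟫ + t := by
    intro t
    rw [inner_add_left, inner_smul_left, real_inner_self_eq_norm_sq, hθ]; simp
  have hfar : ∀ t : ℝ, R - ⟪x, θ⟫ < t → R < ‖x + t • θ‖ := by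
    intro t ht
    have h := real_inner_le_norm (x + t • θ) θ
    rw [hθ, mul_one, hinn] at h
    linarith
  have hout : ∀ t : ℝ, 0 ≤ t * ⟪x, θ⟫ → R < ‖x + t • θ‖ := by
    intro t ht
    refine lt_of_pow_lt_pow_left₀ 2 (norm_nonneg _) ?_
    rw [hnorm]
    nlinarith [sq_nonneg t]
  set g : ℝ → ℝ := fun t => (f (x + t • θ) + ⟪α (x + t • θ), θ⟫) *
    Real.exp (∫ s in (0 : ℝ)..t, a (x + s • θ)) with hg
  have hg0 : ∀ t : ℝ, R < ‖x + t • θ‖ → g t = 0 := fun t ht => by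
    simp [hg, hf _ ht, hα _ ht]
  change ∫ t in (0 : ℝ)..(R - ⟪x, θ⟫), g t = 0
  rcases le_or_gt 0 ⟪x, θ⟫ with hq | hq
  · refine intervalIntegral.integral_zero_ae (Eventually.of_forall fun t ht => hg0 t ?_)
    rcases le_or_gt 0 t with h0 | h0
    · exact hout t (mul_nonneg h0 hq)
    · refine hfar t ?_
      rcases mem_uIoc.1 ht with h | h
      · exact absurd h.1 (not_lt.2 h0.le)
      · exact h.1
  · rw [intervalIntegral.integral_of_le (by linarith)]
    refine Eq.trans ?_ hint
    refine setIntegral_eq_integral_of_forall_compl_eq_zero fun t ht => hg0 t ?_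
    rcases le_or_gt t 0 with h0 | h0
    · exact hout t (mul_nonneg_of_nonpos_of_nonpos h0 hq.le)
    · exact hfar t (not_le.1 fun h => ht ⟨h0, h⟩)

/-- The partial derivative of a function on `ℝ³` in the `i`-th coordinate. -/
def partialDeriv (i : Fin 3) (g : (Fin 3 → ℝ) → ℝ) (z : Fin 3 → ℝ) : ℝ :=
  fderiv ℝ g z (Pi.single i 1)

/-- The derivative along the vector field `z₁ ∂₀ - z₀ ∂₁ + ∂₂`: in the coordinates of a parallel
beam this is the derivative in the direction variable with the base point held fixed. -/
def verticalDeriv (g : (Fin 3 → ℝ) → ℝ) (z : Fin 3 → ℝ) : ℝ :=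
  partialDeriv 2 g z + z 1 * partialDeriv 0 g z - z 0 * partialDeriv 1 g z

theorem contDiff_partialDeriv {g : (Fin 3 → ℝ) → ℝ} (hg : ContDiff ℝ (⊤ : ℕ∞) g) (i : Fin 3) :
    ContDiff ℝ (⊤ : ℕ∞) (partialDeriv i g) :=
  (hg.fderiv_right (m := (⊤ : ℕ∞)) (by simp)).clm_apply contDiff_const

theorem contDiff_coord (i : Fin 3) : ContDiff ℝ (⊤ : ℕ∞) fun z : Fin 3 → ℝ => z i :=
  contDiff_apply ℝ ℝ i

theorem contDiff_verticalDeriv {g : (Fin 3 → ℝ) → ℝ} (hg : ContDiff ℝ (⊤ : ℕ∞) g) :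
    ContDiff ℝ (⊤ : ℕ∞) (verticalDeriv g) :=
  ((contDiff_partialDeriv hg 2).add ((contDiff_coord 1).mul (contDiff_partialDeriv hg 0))).sub
    ((contDiff_coord 0).mul (contDiff_partialDeriv hg 1))

section Rules

variable {g h : (Fin 3 → ℝ) → ℝ} {z : Fin 3 → ℝ} (i : Fin 3)

theorem partialDeriv_add (hg : DifferentiableAt ℝ g z) (hh : DifferentiableAt ℝ h z) :
    partialDeriv i (fun z => g z + h z) z = partialDeriv i g z + partialDeriv i h z := by
  simp [partialDeriv, fderiv_fun_add hg hh]

theorem partialDeriv_sub (hg : DifferentiableAt ℝ g z) (hh : DifferentiableAt ℝ h z) :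
    partialDeriv i (fun z => g z - h z) z = partialDeriv i g z - partialDeriv i h z := by
  simp [partialDeriv, fderiv_fun_sub hg hh]

theorem partialDeriv_const (c : ℝ) : partialDeriv i (fun _ => c) z = 0 := by
  simp [partialDeriv]

theorem partialDeriv_neg :
    partialDeriv i (fun z => -g z) z = -partialDeriv i g z := by
  simp [partialDeriv, fderiv_fun_neg]

theorem partialDeriv_mul (hg : DifferentiableAt ℝ g z) (hh : DifferentiableAt ℝ h z) :
    partialDeriv i (fun z => g z * h z) z =
      partialDeriv i g z * h z + g z * partialDeriv i h z := by
  simp [partialDeriv, fderiv_fun_mul hg hh]; ring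

theorem partialDeriv_coord (j : Fin 3) :
    partialDeriv i (fun z => z j) z = if j = i then 1 else 0 := by
  have : HasFDerivAt (fun z : Fin 3 → ℝ => z j) (ContinuousLinearMap.proj (R := ℝ) j) z :=
    hasFDerivAt_apply j z
  simp [partialDeriv, this.fderiv, Pi.single_apply]

theorem partialDeriv_comm (hg : ContDiff ℝ (⊤ : ℕ∞) g) (j : Fin 3) :
    partialDeriv i (partialDeriv j g) z = partialDeriv j (partialDeriv i g) z := by
  have hd : DifferentiableAt ℝ (fderiv ℝ g) z :=
    ((hg.fderiv_right (m := (⊤ : ℕ∞)) (by simp)).differentiable (by simp)).differentiableAt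
  have hsym : IsSymmSndFDerivAt ℝ g z :=
    hg.contDiffAt.isSymmSndFDerivAt (by
      rw [minSmoothness_of_isRCLikeNormedField]
      exact WithTop.coe_le_coe.2 (le_top (a := (2 : ℕ∞))))
  have key : ∀ i j : Fin 3, partialDeriv i (partialDeriv j g) z =
      fderiv ℝ (fderiv ℝ g) z (Pi.single i 1) (Pi.single j 1) := by
    intro i j
    unfold partialDeriv
    rw [fderiv_clm_apply hd (differentiableAt_const _)]
    simp
  rw [key, key, hsym.eq]

end Rules

/-- A Pestov identity for the attenuated transport equation, in divergence form. -/
theorem pestov_divergence {u a f A B W : (Fin 3 → ℝ) → ℝ} {k : ℝ}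
    (hu : ContDiff ℝ (⊤ : ℕ∞) u) (ha : ContDiff ℝ (⊤ : ℕ∞) a) (hf : ContDiff ℝ (⊤ : ℕ∞) f)
    (hA : ContDiff ℝ (⊤ : ℕ∞) A) (hB : ContDiff ℝ (⊤ : ℕ∞) B) (hW : ContDiff ℝ (⊤ : ℕ∞) W)
    (htransport : ∀ z, partialDeriv 0 u z = -(a z * u z) - f z - A z)
    (hVa : ∀ z, verticalDeriv a z = 0) (hVf : ∀ z, verticalDeriv f z = 0)
    (hVA : ∀ z, verticalDeriv A z = B z) (hVB : ∀ z, verticalDeriv B z = -A z)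
    (hRiccati : ∀ z, partialDeriv 0 W z * verticalDeriv u z =
      k ^ 2 * verticalDeriv u z ^ 2 + W z ^ 2 + W z * partialDeriv 0 (verticalDeriv u) z)
    {S : (Fin 3 → ℝ) → ℝ}
    (hS : S = fun z => partialDeriv 1 u z * partialDeriv 0 u z -
      (2 * (a z * u z * B z) + A z * B z + 2 * (f z * B z)))
    (z : Fin 3 → ℝ) :
    partialDeriv 0 (fun z => (partialDeriv 1 u z - W z) * verticalDeriv u z + z 1 * S z) z +
      partialDeriv 1 (fun z => -(partialDeriv 0 u z * verticalDeriv u z) - z 0 * S z) z +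
      partialDeriv 2 S z =
    -((k ^ 2 - a z ^ 2) * verticalDeriv u z ^ 2 + (a z * u z + f z) ^ 2 +
      (partialDeriv 0 (verticalDeriv u) z + W z) ^ 2) := by
  have diff : ∀ {g : (Fin 3 → ℝ) → ℝ}, ContDiff ℝ (⊤ : ℕ∞) g → DifferentiableAt ℝ g z :=
    fun hg => (hg.differentiable (by simp)).differentiableAt
  have hp := fun i => contDiff_partialDeriv hu i
  have hw := contDiff_verticalDeriv hu
  have hc := fun i => contDiff_coord i
  have hSs : ContDiff ℝ (⊤ : ℕ∞) S := by
    rw [hS]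
    exact ((hp 1).mul (hp 0)).sub (((contDiff_const.mul ((ha.mul hu).mul hB)).add (hA.mul hB)).add
      (contDiff_const.mul (hf.mul hB)))
  have da := diff ha
  have du := diff hu
  have df := diff hf
  have dA := diff hA
  have dB := diff hB
  have dW := diff hW
  have d0 := diff (hp 0)
  have d1 := diff (hp 1)
  have d2 := diff (hp 2)
  have ddw := diff hw
  have ddS := diff hSs
  have dS : ∀ i, partialDeriv i S z =
      partialDeriv i (partialDeriv 1 u) z * partialDeriv 0 u z +
        partialDeriv 1 u z * partialDeriv i (partialDeriv 0 u) z -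
      (2 * ((partialDeriv i a z * u z + a z * partialDeriv i u z) * B z
        + a z * u z * partialDeriv i B z) +
        (partialDeriv i A z * B z + A z * partialDeriv i B z) +
        2 * (partialDeriv i f z * B z + f z * partialDeriv i B z)) := by
    intro i
    rw [hS]
    simp (disch := fun_prop) only [partialDeriv_sub, partialDeriv_add, partialDeriv_mul,
      partialDeriv_const, zero_mul, zero_add]
  have dw : ∀ i, partialDeriv i (verticalDeriv u) z = partialDeriv i (partialDeriv 2 u) z +
      ((if (1 : Fin 3) = i then 1 else 0) * partialDeriv 0 u z +
        z 1 * partialDeriv i (partialDeriv 0 u) z) -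
      ((if (0 : Fin 3) = i then 1 else 0) * partialDeriv 1 u z +
        z 0 * partialDeriv i (partialDeriv 1 u) z) := by
    intro i
    unfold verticalDeriv
    simp (disch := fun_prop) only [partialDeriv_sub, partialDeriv_add, partialDeriv_mul,
      partialDeriv_coord]
  have dX : ∀ i, partialDeriv i (partialDeriv 0 u) z =
      -(partialDeriv i a z * u z + a z * partialDeriv i u z) - partialDeriv i f z -
        partialDeriv i A z := by
    intro i
    rw [funext htransport]
    simp (disch := fun_prop) only [partialDeriv_sub, partialDeriv_neg, partialDeriv_mul]
  have hVX : partialDeriv 2 (partialDeriv 0 u) z + z 1 * partialDeriv 0 (partialDeriv 0 u) z -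
      z 0 * partialDeriv 1 (partialDeriv 0 u) z = -(a z * verticalDeriv u z) - B z := by
    have h1 := hVa z
    have h2 := hVf z
    have h3 := hVA z
    unfold verticalDeriv at h1 h2 h3 ⊢
    rw [dX, dX, dX]
    linear_combination -(u z) * h1 - h2 - h3
  simp (disch := fun_prop) only [partialDeriv_sub, partialDeriv_add, partialDeriv_neg,
    partialDeriv_mul, partialDeriv_coord]
  have h1 := hVa z
  have h2 := hVf z
  have h3 := hVA z
  have h4 := hVB z
  have h5 := hRiccati z
  have h6 := htransport z
  have hw0 : verticalDeriv u z =
    partialDeriv 2 u z + z 1 * partialDeriv 0 u z - z 0 * partialDeriv 1 u z := rfl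
  have hVS : partialDeriv 2 S z + z 1 * partialDeriv 0 S z - z 0 * partialDeriv 1 S z =
      (partialDeriv 2 (partialDeriv 1 u) z + z 1 * partialDeriv 0 (partialDeriv 1 u) z -
        z 0 * partialDeriv 1 (partialDeriv 1 u) z) * partialDeriv 0 u z +
      partialDeriv 1 u z * (-(a z * verticalDeriv u z) - B z) -
      (2 * (a z * verticalDeriv u z * B z) - 2 * (a z * u z * A z) + B z ^ 2 - A z ^ 2
        - 2 * (f z * A z)) := by
    rw [hw0] at hVX ⊢
    rw [dS, dS, dS, ← hVX]
    unfold verticalDeriv at h1 h2 h3 h4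
    linear_combination (-2 * u z * B z) * h1 - 2 * B z * h2 - B z * h3 -
      (2 * a z * u z + A z + 2 * f z) * h4
  have e0 := dw 0
  have e1 := dw 1
  simp only [Fin.isValue, one_ne_zero, zero_ne_one, if_true, if_false, zero_mul, one_mul,
    zero_add] at e0 e1 ⊢
  have c01 := partialDeriv_comm (z := z) 0 hu 1
  have c02 := partialDeriv_comm (z := z) 0 hu 2
  have c12 := partialDeriv_comm (z := z) 1 hu 2
  have hA' : A z = -(a z * u z) - f z - partialDeriv 0 u z := by linear_combination h6
  have hB' : B z = -(a z * verticalDeriv u z) - partialDeriv 1 u z -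
      partialDeriv 0 (verticalDeriv u) z := by
    linear_combination hVX + e0 + c02 - z 0 * c01
  rw [hA', hB'] at hVS
  linear_combination hVS - h5 - partialDeriv 0 u z * (e1 + c12 - z 1 * c01) +
    verticalDeriv u z * c01

theorem partialDeriv_eq_zero_of_eqOn {g : (Fin 3 → ℝ) → ℝ} {O : Set (Fin 3 → ℝ)} (hO : IsOpen O)
    (hg : ∀ z ∈ O, g z = 0) (i : Fin 3) {z : Fin 3 → ℝ} (hz : z ∈ O) : partialDeriv i g z = 0 := by
  have : g =ᶠ[𝓝 z] fun _ => 0 := by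
    filter_upwards [hO.mem_nhds hz] with y hy using hg y hy
  simp [partialDeriv, this.fderiv_eq]

theorem partialDeriv_periodic {g : (Fin 3 → ℝ) → ℝ} {c : Fin 3 → ℝ} (hg : ∀ z, g (z + c) = g z)
    (i : Fin 3) (z : Fin 3 → ℝ) : partialDeriv i g (z + c) = partialDeriv i g z := by
  unfold partialDeriv
  rw [← fderiv_comp_add_right]
  simp_rw [hg]

theorem partialDeriv_tan {k : ℝ} {z : Fin 3 → ℝ} (hz : Real.cos (k * z 0) ≠ 0) :
    DifferentiableAt ℝ (fun z : Fin 3 → ℝ => k * Real.tan (k * z 0)) z ∧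
      partialDeriv 0 (fun z : Fin 3 → ℝ => k * Real.tan (k * z 0)) z =
        k ^ 2 + (k * Real.tan (k * z 0)) ^ 2 := by
  have h1 : HasFDerivAt (fun z : Fin 3 → ℝ => k * z 0)
      (k • ContinuousLinearMap.proj (R := ℝ) (φ := fun _ : Fin 3 => ℝ) 0) z :=
    (hasFDerivAt_apply 0 z).const_mul k
  have h2 := ((Real.hasDerivAt_tan hz).comp_hasFDerivAt z h1).const_mul k
  refine ⟨h2.differentiableAt, ?_⟩
  unfold partialDeriv
  erw [h2.fderiv]
  simp [Real.tan_eq_sin_div_cos]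
  field_simp
  linear_combination -k ^ 2 * Real.sin_sq_add_cos_sq (k * z 0)

theorem setIntegral_divergence_eq_zero {F : Fin 3 → (Fin 3 → ℝ) → ℝ}
    (hF : ∀ i, ContDiff ℝ (⊤ : ℕ∞) (F i)) {L c T : ℝ} (hL : 0 ≤ L) (hT : 0 ≤ T)
    (hsupp : ∀ i z, L ^ 2 ≤ z 0 ^ 2 + z 1 ^ 2 → F i z = 0)
    (hper : ∀ z, F 2 (z + Pi.single 2 T) = F 2 z) :
    ∫ z in Icc ![-L, -L, c] ![L, L, c + T], ∑ i, partialDeriv i (F i) z = 0 := by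
  have hle : ![-L, -L, c] ≤ ![L, L, c + T] := by
    intro i
    fin_cases i <;> simp <;> linarith
  have hcont : Continuous fun z => ∑ i, partialDeriv i (F i) z :=
    continuous_finsetSum _ fun i _ => (contDiff_partialDeriv (hF i) i).continuous
  have key := integral_divergence_of_hasFDerivAt_off_countable' ![-L, -L, c] ![L, L, c + T] hle F
    (fun i => fderiv ℝ (F i)) ∅ countable_empty (fun i => (hF i).continuous.continuousOn)
    (fun z _ i => ((hF i).differentiable (by simp) z).hasFDerivAt)
    (hcont.continuousOn.integrableOn_compact isCompact_Icc)
  refine key.trans ?_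
  rw [Fin.sum_univ_three]
  have e0 : ∀ (b : ℝ) (x : Fin 2 → ℝ), b ^ 2 = L ^ 2 →
      F 0 (Fin.cons (α := fun _ => ℝ) b x) = 0 := by
    intro b x hb
    refine hsupp 0 _ ?_
    rw [Fin.cons_zero, hb]
    nlinarith [sq_nonneg ((Fin.cons b x : Fin 3 → ℝ) 1)]
  have e1 : ∀ (b : ℝ) (x : Fin 2 → ℝ), b ^ 2 = L ^ 2 →
      F 1 ((1 : Fin 3).insertNth (α := fun _ => ℝ) b x) = 0 := by
    intro b x hb
    refine hsupp 1 _ ?_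
    rw [Fin.insertNth_apply_same, hb]
    nlinarith [sq_nonneg ((1 : Fin 3).insertNth (α := fun _ => ℝ) b x 0)]
  have e2 : ∀ x : Fin 2 → ℝ, F 2 ((2 : Fin 3).insertNth (α := fun _ => ℝ) (c + T) x) =
      F 2 ((2 : Fin 3).insertNth (α := fun _ => ℝ) c x) := by
    intro x
    rw [← hper ((2 : Fin 3).insertNth (α := fun _ => ℝ) c x)]
    congr 1
    ext j
    refine Fin.succAboveCases (2 : Fin 3) ?_ (fun j => ?_) j
    · simp
    · simp [Fin.succAbove_ne]
  simp [e0, e1, e2]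

/-- Uniqueness for the attenuated transport equation on the circle bundle of a disc, written in
parallel beam coordinates: a solution that vanishes outside the disc does not depend on the
direction. -/
theorem verticalDeriv_eq_zero {u a f A B : (Fin 3 → ℝ) → ℝ} {k R : ℝ} (hR : 0 < R)
    (hu : ContDiff ℝ (⊤ : ℕ∞) u) (ha : ContDiff ℝ (⊤ : ℕ∞) a) (hf : ContDiff ℝ (⊤ : ℕ∞) f)
    (hA : ContDiff ℝ (⊤ : ℕ∞) A) (hB : ContDiff ℝ (⊤ : ℕ∞) B)
    (htransport : ∀ z, partialDeriv 0 u z = -(a z * u z) - f z - A z)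
    (hVa : ∀ z, verticalDeriv a z = 0) (hVf : ∀ z, verticalDeriv f z = 0)
    (hVA : ∀ z, verticalDeriv A z = B z) (hVB : ∀ z, verticalDeriv B z = -A z)
    (hak : ∀ z, |a z| < k) (hkR : k * R < Real.pi / 2)
    (hu0 : ∀ z, R ^ 2 < z 0 ^ 2 + z 1 ^ 2 → u z = 0)
    (hB0 : ∀ z, R ^ 2 < z 0 ^ 2 + z 1 ^ 2 → B z = 0)
    (pu : ∀ z, u (z + Pi.single 2 (2 * Real.pi)) = u z)
    (pa : ∀ z, a (z + Pi.single 2 (2 * Real.pi)) = a z)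
    (pf : ∀ z, f (z + Pi.single 2 (2 * Real.pi)) = f z)
    (pA : ∀ z, A (z + Pi.single 2 (2 * Real.pi)) = A z)
    (pB : ∀ z, B (z + Pi.single 2 (2 * Real.pi)) = B z) (z : Fin 3 → ℝ) :
    verticalDeriv u z = 0 := by
  have hk : 0 < k := (abs_nonneg _).trans_lt (hak 0)
  have hopen : IsOpen {z : Fin 3 → ℝ | R ^ 2 < z 0 ^ 2 + z 1 ^ 2} :=
    isOpen_lt continuous_const (by fun_prop)
  have hpu0 : ∀ i, ∀ z : Fin 3 → ℝ, R ^ 2 < z 0 ^ 2 + z 1 ^ 2 → partialDeriv i u z = 0 :=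
    fun i z hz => partialDeriv_eq_zero_of_eqOn hopen hu0 i hz
  have hw0 : ∀ z : Fin 3 → ℝ, R ^ 2 < z 0 ^ 2 + z 1 ^ 2 → verticalDeriv u z = 0 := by
    intro z hz
    simp [verticalDeriv, hpu0 _ z hz]
  have hp := fun i => contDiff_partialDeriv hu i
  have hw := contDiff_verticalDeriv hu
  have hcos : ∀ z : Fin 3 → ℝ, z 0 ^ 2 + z 1 ^ 2 ≤ R ^ 2 → Real.cos (k * z 0) ≠ 0 := by
    intro z hz
    have h : |z 0| ≤ R := abs_le_of_sq_le_sq (by nlinarith [sq_nonneg (z 1)]) hR.le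
    have h' : |k * z 0| < Real.pi / 2 := by
      rw [abs_mul, abs_of_pos hk]
      exact (mul_le_mul_of_nonneg_left h hk.le).trans_lt hkR
    exact (Real.cos_pos_of_mem_Ioo (abs_lt.1 h')).ne'
  have htsupp : tsupport (verticalDeriv u) ⊆ {z : Fin 3 → ℝ | z 0 ^ 2 + z 1 ^ 2 ≤ R ^ 2} := by
    refine closure_minimal (fun z hz => ?_) (isClosed_le (by fun_prop) continuous_const)
    by_contra h
    exact hz (hw0 z (not_le.1 h))
  set W : (Fin 3 → ℝ) → ℝ := fun z => k * Real.tan (k * z 0) * verticalDeriv u z with hWdef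
  have hW : ContDiff ℝ (⊤ : ℕ∞) W := by
    refine contDiff_of_contDiffAt_tsupport fun z hz => ?_
    have hz' := hcos z (htsupp (tsupport_mul_subset_right hz))
    refine (contDiffAt_const.mul ?_).mul hw.contDiffAt
    exact ContDiffAt.comp (g := Real.tan) (f := fun z : Fin 3 → ℝ => k * z 0) z
      (Real.contDiffAt_tan.2 hz') (contDiff_const.mul (contDiff_coord 0)).contDiffAt
  have hRiccati : ∀ z, partialDeriv 0 W z * verticalDeriv u z =
      k ^ 2 * verticalDeriv u z ^ 2 + W z ^ 2 + W z * partialDeriv 0 (verticalDeriv u) z := by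
    intro z
    rcases le_or_gt (z 0 ^ 2 + z 1 ^ 2) (R ^ 2) with hz | hz
    · obtain ⟨h1, h2⟩ := partialDeriv_tan (hcos z hz)
      rw [hWdef, partialDeriv_mul 0 h1 (hw.differentiable (by simp) z), h2]
      ring
    · simp [hWdef, hw0 z hz]
  set S : (Fin 3 → ℝ) → ℝ := fun z => partialDeriv 1 u z * partialDeriv 0 u z -
      (2 * (a z * u z * B z) + A z * B z + 2 * (f z * B z)) with hSdef
  have hS : ContDiff ℝ (⊤ : ℕ∞) S :=
    ((hp 1).mul (hp 0)).sub (((contDiff_const.mul ((ha.mul hu).mul hB)).add (hA.mul hB)).add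
      (contDiff_const.mul (hf.mul hB)))
  have hpestov := pestov_divergence hu ha hf hA hB hW htransport hVa hVf hVA hVB hRiccati hSdef
  set D : (Fin 3 → ℝ) → ℝ := fun z => (k ^ 2 - a z ^ 2) * verticalDeriv u z ^ 2 +
    (a z * u z + f z) ^ 2 + (partialDeriv 0 (verticalDeriv u) z + W z) ^ 2 with hD
  have hDc : Continuous D := by
    have h1 := ha.continuous
    have h2 := hu.continuous
    have h3 := hf.continuous
    have h4 := hw.continuous
    have h5 := hW.continuous
    have h6 := (contDiff_partialDeriv hw 0).continuous
    fun_prop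
  have hka : ∀ z, 0 < k ^ 2 - a z ^ 2 := fun z => sub_pos.2 (sq_lt_sq.2 (by
    rw [abs_of_pos hk]; exact hak z))
  have hD0 : ∀ z, 0 ≤ D z := fun z => by
    have := (hka z).le
    positivity
  have hint : ∫ y in Icc ![-(R + 1), -(R + 1), z 2 - Real.pi]
      ![R + 1, R + 1, z 2 - Real.pi + 2 * Real.pi], D y = 0 := by
    have h := setIntegral_divergence_eq_zero (F := ![
      fun z => (partialDeriv 1 u z - W z) * verticalDeriv u z + z 1 * S z,
      fun z => -(partialDeriv 0 u z * verticalDeriv u z) - z 0 * S z, S])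
      (L := R + 1) (c := z 2 - Real.pi) (T := 2 * Real.pi) ?_ (by linarith) (by positivity) ?_ ?_
    · simp only [Fin.sum_univ_three] at h
      simp only [Matrix.cons_val_zero, Matrix.cons_val_one, Matrix.cons_val, hpestov] at h
      rw [integral_neg, neg_eq_zero] at h
      exact h
    · intro i
      fin_cases i
      · exact (((hp 1).sub hW).mul hw).add ((contDiff_coord 1).mul hS)
      · exact ((hp 0).mul hw).neg.sub ((contDiff_coord 0).mul hS)
      · exact hS
    · intro i y hy
      have hy' : R ^ 2 < y 0 ^ 2 + y 1 ^ 2 := by nlinarith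
      have hS0 : S y = 0 := by simp [hSdef, hpu0 _ y hy', hB0 y hy']
      fin_cases i <;> simp [hS0, hw0 y hy']
    · intro y
      simp [hSdef, partialDeriv_periodic pu, pu, pa, pf, pA, pB]
  rw [setIntegral_eq_zero_iff_of_nonneg_ae (Eventually.of_forall hD0)
    (hDc.continuousOn.integrableOn_compact isCompact_Icc)] at hint
  rcases lt_or_ge (R ^ 2) (z 0 ^ 2 + z 1 ^ 2) with hz | hz
  · exact hw0 z hz
  have hpi := Real.pi_pos
  have hmem : z ∈ interior (Icc ![-(R + 1), -(R + 1), z 2 - Real.pi]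
      ![R + 1, R + 1, z 2 - Real.pi + 2 * Real.pi]) := by
    have h0 : |z 0| ≤ R := abs_le_of_sq_le_sq (by nlinarith [sq_nonneg (z 1)]) hR.le
    have h1 : |z 1| ≤ R := abs_le_of_sq_le_sq (by nlinarith [sq_nonneg (z 0)]) hR.le
    rw [abs_le] at h0 h1
    rw [← pi_univ_Icc, interior_pi_set finite_univ]
    intro i _
    beta_reduce
    rw [interior_Icc]
    fin_cases i <;> simp <;> constructor <;> linarith
  have hDz : D z = 0 := Measure.eqOn_open_of_ae_eq
    (ae_restrict_of_ae_restrict_of_subset interior_subset hint) isOpen_interior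
    hDc.continuousOn continuousOn_const hmem
  have h1 : (k ^ 2 - a z ^ 2) * verticalDeriv u z ^ 2 = 0 := by
    have := (hka z).le
    refine le_antisymm ?_ (by positivity)
    rw [← hDz, hD]
    nlinarith [sq_nonneg (a z * u z + f z), sq_nonneg (partialDeriv 0 (verticalDeriv u) z + W z)]
  exact pow_eq_zero_iff two_ne_zero |>.1 ((mul_eq_zero.1 h1).resolve_left (hka z).ne')

/-- The flow of the vector field `z₁ ∂₀ - z₀ ∂₁ + ∂₂`. -/
def verticalFlow (z : Fin 3 → ℝ) (τ : ℝ) : Fin 3 → ℝ :=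
  ![z 0 * Real.cos τ + z 1 * Real.sin τ, -(z 0 * Real.sin τ) + z 1 * Real.cos τ, z 2 + τ]

theorem verticalFlow_zero (z : Fin 3 → ℝ) : verticalFlow z 0 = z := by
  ext i
  fin_cases i <;> simp [verticalFlow]

theorem hasDerivAt_comp_verticalFlow {g : (Fin 3 → ℝ) → ℝ} (hg : Differentiable ℝ g)
    (z : Fin 3 → ℝ) (τ : ℝ) :
    HasDerivAt (fun τ => g (verticalFlow z τ)) (verticalDeriv g (verticalFlow z τ)) τ := by
  set y := verticalFlow z τ with hy
  have hflow : HasDerivAt (verticalFlow z) ![y 1, -y 0, 1] τ := by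
    rw [hasDerivAt_pi]
    intro i
    have hs := Real.hasDerivAt_sin τ
    have hc := Real.hasDerivAt_cos τ
    fin_cases i
    · refine ((hc.const_mul (z 0)).add (hs.const_mul (z 1))).congr_deriv ?_
      simp [hy, verticalFlow]
    · refine ((hs.const_mul (z 0)).neg.add (hc.const_mul (z 1))).congr_deriv ?_
      simp [hy, verticalFlow]; ring
    · exact (hasDerivAt_id τ).const_add (z 2)
  refine ((hg y).hasFDerivAt.comp_hasDerivAt τ hflow).congr_deriv ?_
  have hv : ![y 1, -y 0, 1] = y 1 • Pi.single 0 1 - y 0 • Pi.single 1 1 +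
      (Pi.single 2 1 : Fin 3 → ℝ) := by
    ext i
    fin_cases i <;> simp
  rw [hv, map_add, map_sub, map_smul, map_smul]
  simp only [verticalDeriv, partialDeriv, smul_eq_mul]
  ring

theorem verticalDeriv_eq_of_hasDerivAt {g : (Fin 3 → ℝ) → ℝ} (hg : ContDiff ℝ (⊤ : ℕ∞) g)
    {z : Fin 3 → ℝ} {g' : ℝ} (h : HasDerivAt (fun τ => g (verticalFlow z τ)) g' 0) :
    verticalDeriv g z = g' := by
  have := hasDerivAt_comp_verticalFlow (hg.differentiable (by simp)) z 0
  rw [verticalFlow_zero] at this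
  exact this.unique h

theorem fderiv_apply_eq_of_hasDerivAt {V : Type*} [NormedAddCommGroup V] [NormedSpace ℝ V]
    {g : V → ℝ} (hg : ContDiff ℝ (⊤ : ℕ∞) g) {x v : V} {g' : ℝ}
    (h : HasDerivAt (fun τ : ℝ => g (x + τ • v)) g' 0) : fderiv ℝ g x v = g' := by
  have h1 : HasDerivAt (fun τ : ℝ => x + τ • v) v 0 := by
    simpa using ((hasDerivAt_id (0 : ℝ)).smul_const v).const_add x
  have h2 : HasFDerivAt g (fderiv ℝ g x) (x + (0 : ℝ) • v) := by
    simpa using (hg.differentiable (by simp) x).hasFDerivAt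
  exact (h2.comp_hasDerivAt 0 h1).unique h

/-- The unit vector at angle `φ` in the plane of the orthonormal vectors `v` and `w`. -/
def beamDir (v w : E) (φ : ℝ) : E := Real.cos φ • v + Real.sin φ • w

/-- The point with parallel beam coordinates `z` in the plane through `p₀` spanned by `v`, `w`. -/
def beamPoint (p₀ v w : E) (z : Fin 3 → ℝ) : E :=
  p₀ + ((z 0 * Real.cos (z 2) - z 1 * Real.sin (z 2)) • v +
    (z 0 * Real.sin (z 2) + z 1 * Real.cos (z 2)) • w)

theorem contDiff_beamDir (v w : E) : ContDiff ℝ (⊤ : ℕ∞) (beamDir v w) :=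
  (Real.contDiff_cos.smul contDiff_const).add (Real.contDiff_sin.smul contDiff_const)

theorem contDiff_beamPoint (p₀ v w : E) : ContDiff ℝ (⊤ : ℕ∞) (beamPoint p₀ v w) := by
  have hc := fun i => contDiff_coord i
  have hcos := (hc 2).cos
  have hsin := (hc 2).sin
  exact contDiff_const.add (((((hc 0).mul hcos).sub ((hc 1).mul hsin)).smul contDiff_const).add
    ((((hc 0).mul hsin).add ((hc 1).mul hcos)).smul contDiff_const))

theorem hasDerivAt_beamDir (v w : E) (φ : ℝ) :
    HasDerivAt (beamDir v w) (beamDir w (-v) φ) φ := by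
  refine (((Real.hasDerivAt_cos φ).smul_const v).add
    ((Real.hasDerivAt_sin φ).smul_const w)).congr_deriv ?_
  simp only [beamDir]
  module

theorem beamPoint_verticalFlow (p₀ v w : E) (z : Fin 3 → ℝ) (τ : ℝ) :
    beamPoint p₀ v w (verticalFlow z τ) = beamPoint p₀ v w z := by
  have h := Real.sin_sq_add_cos_sq τ
  have h0 : verticalFlow z τ 0 = z 0 * Real.cos τ + z 1 * Real.sin τ := rfl
  have h1 : verticalFlow z τ 1 = -(z 0 * Real.sin τ) + z 1 * Real.cos τ := rfl
  have h2 : verticalFlow z τ 2 = z 2 + τ := rfl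
  unfold beamPoint
  rw [h0, h1, h2, Real.cos_add, Real.sin_add]
  congr 3
  · linear_combination (z 0 * Real.cos (z 2) - z 1 * Real.sin (z 2)) * h
  · linear_combination (z 0 * Real.sin (z 2) + z 1 * Real.cos (z 2)) * h

theorem beamPoint_add_single_zero (p₀ v w : E) (z : Fin 3 → ℝ) (τ : ℝ) :
    beamPoint p₀ v w (z + τ • Pi.single 0 1) = beamPoint p₀ v w z + τ • beamDir v w (z 2) := by
  simp only [beamPoint, beamDir, Pi.add_apply, Pi.smul_apply, Pi.single_apply, smul_eq_mul]
  simp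
  module

theorem beamPoint_add_single_two (p₀ v w : E) (z : Fin 3 → ℝ) :
    beamPoint p₀ v w (z + Pi.single 2 (2 * Real.pi)) = beamPoint p₀ v w z := by
  simp [beamPoint]

theorem beamDir_add_two_pi (v w : E) (φ : ℝ) :
    beamDir v w (φ + 2 * Real.pi) = beamDir v w φ := by
  simp [beamDir]

theorem norm_beamDir {v w : E} (hv : ‖v‖ = 1) (hw : ‖w‖ = 1) (hvw : ⟪v, w⟫ = 0) (φ : ℝ) :
    ‖beamDir v w φ‖ = 1 := by
  have h : ‖beamDir v w φ‖ ^ 2 = 1 := by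
    rw [beamDir, norm_add_sq_real, norm_smul, norm_smul, inner_smul_left, inner_smul_right, hvw,
      hv, hw, mul_one, mul_one, Real.norm_eq_abs, Real.norm_eq_abs, sq_abs, sq_abs]
    linear_combination Real.sin_sq_add_cos_sq φ
  exact (pow_eq_one_iff_of_nonneg (norm_nonneg _) two_ne_zero).1 h

theorem le_norm_sq_beamPoint {p₀ v w : E} (hv : ‖v‖ = 1) (hw : ‖w‖ = 1) (hvw : ⟪v, w⟫ = 0)
    (hpv : ⟪p₀, v⟫ = 0) (hpw : ⟪p₀, w⟫ = 0) (z : Fin 3 → ℝ) :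
    z 0 ^ 2 + z 1 ^ 2 ≤ ‖beamPoint p₀ v w z‖ ^ 2 := by
  rw [beamPoint, norm_add_sq_real, inner_add_right, inner_smul_right, inner_smul_right, hpv, hpw,
    norm_add_sq_real, norm_smul, norm_smul, inner_smul_left, inner_smul_right, hvw,
    hv, hw, mul_one, mul_one, Real.norm_eq_abs, Real.norm_eq_abs, sq_abs, sq_abs]
  have h := Real.sin_sq_add_cos_sq (z 2)
  have : z 0 ^ 2 + z 1 ^ 2 = (z 0 * Real.cos (z 2) - z 1 * Real.sin (z 2)) ^ 2 +
      (z 0 * Real.sin (z 2) + z 1 * Real.cos (z 2)) ^ 2 := by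
    linear_combination -(z 0 ^ 2 + z 1 ^ 2) * h
  simp only [mul_zero, add_zero]
  rw [this]
  linarith [sq_nonneg ‖p₀‖]

theorem attenuatedRay_beamDir {R k : ℝ} (hR : 0 < R) {a f : E → ℝ} {α : E → E}
    (ha : ContDiff ℝ (⊤ : ℕ∞) a) (hf : ContDiff ℝ (⊤ : ℕ∞) f) (hα : ContDiff ℝ (⊤ : ℕ∞) α)
    (hf0 : ∀ x, R < ‖x‖ → f x = 0) (hα0 : ∀ x, R < ‖x‖ → α x = 0)
    (hak : ∀ x, |a x| < k) (hkR : k * R < Real.pi / 2)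
    (hvanish : ∀ x θ : E, ‖θ‖ = 1 → (∫ t : ℝ, (f (x + t • θ) + ⟪α (x + t • θ), θ⟫) *
        Real.exp (∫ s in (0 : ℝ)..t, a (x + s • θ))) = 0)
    {v w : E} (hv : ‖v‖ = 1) (hw : ‖w‖ = 1) (hvw : ⟪v, w⟫ = 0) (x : E) (φ : ℝ) :
    attenuatedRay R a f α x (beamDir v w φ) = attenuatedRay R a f α x v := by
  set p₀ : E := x - ⟪x, v⟫ • v - ⟪x, w⟫ • w with hp₀
  have hwv : ⟪w, v⟫ = 0 := by rw [real_inner_comm, hvw]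
  have hpv : ⟪p₀, v⟫ = 0 := by
    simp [hp₀, inner_sub_left, inner_smul_left, hwv, hv]
  have hpw : ⟪p₀, w⟫ = 0 := by
    simp [hp₀, inner_sub_left, inner_smul_left, hvw, hw]
  set γ := beamPoint p₀ v w with hγ
  have hγs : ContDiff ℝ (⊤ : ℕ∞) γ := contDiff_beamPoint p₀ v w
  have hθs : ContDiff ℝ (⊤ : ℕ∞) fun z : Fin 3 → ℝ => beamDir v w (z 2) :=
    (contDiff_beamDir v w).comp (contDiff_coord 2)
  have hνs : ContDiff ℝ (⊤ : ℕ∞) fun z : Fin 3 → ℝ => beamDir w (-v) (z 2) :=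
    (contDiff_beamDir w (-v)).comp (contDiff_coord 2)
  have hflow2 : ∀ z τ, verticalFlow z τ 2 = z 2 + τ := fun z τ => rfl
  have hγflow : ∀ z τ, γ (verticalFlow z τ) = γ z := beamPoint_verticalFlow p₀ v w
  have hout : ∀ z : Fin 3 → ℝ, R ^ 2 < z 0 ^ 2 + z 1 ^ 2 → R < ‖γ z‖ := fun z hz =>
    lt_of_pow_lt_pow_left₀ 2 (norm_nonneg _)
      (hz.trans_le (le_norm_sq_beamPoint hv hw hvw hpv hpw z))
  have hγper : ∀ z, γ (z + Pi.single 2 (2 * Real.pi)) = γ z := beamPoint_add_single_two p₀ v w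
  set u : (Fin 3 → ℝ) → ℝ := fun z => attenuatedRay R a f α (γ z) (beamDir v w (z 2)) with hu
  have hus : ContDiff ℝ (⊤ : ℕ∞) u := (contDiff_attenuatedRay R ha hf hα).comp (hγs.prodMk hθs)
  have hθ := norm_beamDir hv hw hvw
  have hdir : ∀ (v w : E) (φ : ℝ), HasDerivAt (fun τ => beamDir v w (φ + τ)) (beamDir w (-v) φ) 0 :=
    fun v w φ => HasDerivAt.comp_const_add φ 0 (by simpa using hasDerivAt_beamDir v w φ)
  have hAs : ContDiff ℝ (⊤ : ℕ∞) fun z => ⟪α (γ z), beamDir v w (z 2)⟫ :=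
    (hα.comp hγs).inner ℝ hθs
  have hBs : ContDiff ℝ (⊤ : ℕ∞) fun z => ⟪α (γ z), beamDir w (-v) (z 2)⟫ :=
    (hα.comp hγs).inner ℝ hνs
  have hvert := verticalDeriv_eq_zero (u := u) (a := a ∘ γ) (f := f ∘ γ)
    (A := fun z => ⟪α (γ z), beamDir v w (z 2)⟫)
    (B := fun z => ⟪α (γ z), beamDir w (-v) (z 2)⟫) (k := k) hR hus (ha.comp hγs) (hf.comp hγs)
    hAs hBs ?_ ?_ ?_ ?_ ?_ (fun z => hak _) hkR ?_ ?_ ?_ ?_ ?_ ?_ ?_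
  · set z : Fin 3 → ℝ := ![⟪x, v⟫, ⟪x, w⟫, 0] with hz
    have hγz : γ z = x := by
      simp [hγ, beamPoint, hz, hp₀]
    have hconst := is_const_of_deriv_eq_zero (f := fun τ => u (verticalFlow z τ))
      (fun τ => (hasDerivAt_comp_verticalFlow (hus.differentiable (by simp)) z τ).differentiableAt)
      (fun τ => by
        rw [(hasDerivAt_comp_verticalFlow (hus.differentiable (by simp)) z τ).deriv, hvert])
      φ 0
    have hz2 : z 2 = 0 := rfl
    simpa [hu, hγflow, hγz, hflow2, hz2, beamDir] using hconst
  · intro z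
    refine fderiv_apply_eq_of_hasDerivAt hus ?_
    have h := hasDerivAt_attenuatedRay R ha.continuous hf.continuous hα.continuous (γ z)
      (hθ (z 2))
    have hcomp : (fun τ : ℝ => u (z + τ • Pi.single 0 1)) = fun τ : ℝ =>
        attenuatedRay R a f α (γ z + τ • beamDir v w (z 2)) (beamDir v w (z 2)) := by
      ext τ
      simp [hu, hγ, beamPoint_add_single_zero]
    rw [hcomp]
    exact h
  · intro z
    refine verticalDeriv_eq_of_hasDerivAt (ha.comp hγs) ?_
    simpa [hγflow] using hasDerivAt_const (0 : ℝ) (a (γ z))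
  · intro z
    refine verticalDeriv_eq_of_hasDerivAt (hf.comp hγs) ?_
    simpa [hγflow] using hasDerivAt_const (0 : ℝ) (f (γ z))
  · intro z
    refine verticalDeriv_eq_of_hasDerivAt hAs ?_
    simp only [hγflow, hflow2]
    simpa using (hasDerivAt_const (0 : ℝ) (α (γ z))).inner ℝ (hdir v w (z 2))
  · intro z
    refine verticalDeriv_eq_of_hasDerivAt hBs ?_
    simp only [hγflow, hflow2]
    have h := (hasDerivAt_const (0 : ℝ) (α (γ z))).inner ℝ (hdir w (-v) (z 2))
    refine h.congr_deriv ?_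
    simp [beamDir, inner_add_right, inner_smul_right]
    ring
  · intro z hz
    exact attenuatedRay_eq_zero hR.le hf0 hα0 (hθ _) (hvanish _ _ (hθ _)) (hout z hz)
  · intro z hz
    simp [hα0 _ (hout z hz)]
  · intro z
    simp [hu, hγper, beamDir_add_two_pi]
  · intro z
    simp [hγper]
  · intro z
    simp [hγper]
  · intro z
    simp [hγper, beamDir_add_two_pi]
  · intro z
    simp [hγper, beamDir_add_two_pi]

theorem exists_bound_of_tsupport_subset {R : ℝ} (hR : 0 < R) {n : ℕ}
    {a : EuclideanSpace ℝ (Fin n) → ℝ} (ha : Continuous a)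
    (hsa : tsupport a ⊆ Metric.closedBall 0 R) (hsmall : ∀ x, |a x| < Real.pi / (2 * R)) :
    ∃ k, (∀ x, |a x| < k) ∧ k * R < Real.pi / 2 := by
  obtain ⟨y, -, hy⟩ := (isCompact_closedBall (0 : EuclideanSpace ℝ (Fin n)) R).exists_isMaxOn
    ⟨0, by simp [hR.le]⟩ ha.abs.continuousOn
  have hle : ∀ x, |a x| ≤ |a y| := fun x => by
    by_cases hx : x ∈ Metric.closedBall (0 : EuclideanSpace ℝ (Fin n)) R
    · exact hy hx
    · rw [image_eq_zero_of_notMem_tsupport fun h => hx (hsa h), abs_zero]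
      exact abs_nonneg _
  obtain ⟨k, hk₁, hk₂⟩ := exists_between (hsmall y)
  refine ⟨k, fun x => (hle x).trans_lt hk₁, ?_⟩
  have := (lt_div_iff₀ (by positivity)).1 hk₂
  linarith

theorem eq_zero_of_tsupport_subset_closedBall {V F : Type*} [NormedAddCommGroup V] [Zero F]
    {g : V → F} {R : ℝ} (hg : tsupport g ⊆ Metric.closedBall 0 R) {x : V} (hx : R < ‖x‖) :
    g x = 0 :=
  image_eq_zero_of_notMem_tsupport fun h => by
    simpa [hx.not_ge] using hg h

theorem attenuatedRay_eq_of_orthonormal {ι : Type*} {e : ι → E} (he : Orthonormal ℝ e)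
    {R k : ℝ} (hR : 0 < R) {a f : E → ℝ} {α : E → E}
    (ha : ContDiff ℝ (⊤ : ℕ∞) a) (hf : ContDiff ℝ (⊤ : ℕ∞) f) (hα : ContDiff ℝ (⊤ : ℕ∞) α)
    (hf0 : ∀ x, R < ‖x‖ → f x = 0) (hα0 : ∀ x, R < ‖x‖ → α x = 0)
    (hak : ∀ x, |a x| < k) (hkR : k * R < Real.pi / 2)
    (hvanish : ∀ x θ : E, ‖θ‖ = 1 →
      (∫ t : ℝ, (f (x + t • θ) + ⟪α (x + t • θ), θ⟫) *
        Real.exp (∫ s in (0 : ℝ)..t, a (x + s • θ))) = 0)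
    {i₀ i₁ : ι} (hne : i₀ ≠ i₁) (j : ι) (y : E) :
    attenuatedRay R a f α y (e j) = attenuatedRay R a f α y (e i₀) ∧
      attenuatedRay R a f α y (-e j) = attenuatedRay R a f α y (e i₀) := by
  have hrot : ∀ j, i₀ ≠ j → ∀ φ, attenuatedRay R a f α y (beamDir (e i₀) (e j) φ) =
      attenuatedRay R a f α y (e i₀) := fun j hj φ =>
    attenuatedRay_beamDir hR ha hf hα hf0 hα0 hak hkR hvanish
      (he.1 i₀) (he.1 j) (he.2 hj) y φ
  rcases eq_or_ne i₀ j with rfl | hj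
  · exact ⟨rfl, by simpa [beamDir] using hrot i₁ hne Real.pi⟩
  · exact ⟨by simpa [beamDir] using hrot j hj (Real.pi / 2),
      by simpa [beamDir] using hrot j hj (-(Real.pi / 2))⟩

theorem eq_mul_and_inner_eq_fderiv {R : ℝ} {a f U : E → ℝ} {α : E → E}
    (ha : Continuous a) (hf : Continuous f) (hα : Continuous α) (hU : ContDiff ℝ (⊤ : ℕ∞) U)
    {θ : E} (hθ : ‖θ‖ = 1) (hpos : ∀ y, attenuatedRay R a f α y θ = U y)
    (hneg : ∀ y, attenuatedRay R a f α y (-θ) = U y) (x : E) :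
    f x = -(a x * U x) ∧ ⟪α x, θ⟫ = -fderiv ℝ U x θ := by
  have hplus : fderiv ℝ U x θ = -(a x * U x) - f x - ⟪α x, θ⟫ := by
    refine fderiv_apply_eq_of_hasDerivAt hU ?_
    simpa only [hpos] using hasDerivAt_attenuatedRay R ha hf hα x hθ
  have hminus : fderiv ℝ U x (-θ) = -(a x * U x) - f x - ⟪α x, -θ⟫ := by
    refine fderiv_apply_eq_of_hasDerivAt hU ?_
    simpa only [hneg] using hasDerivAt_attenuatedRay R ha hf hα x (θ := -θ) (by rw [norm_neg, hθ])
  rw [map_neg, inner_neg_right] at hminus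
  constructor <;> linarith

theorem exists_gradient_of_attenuatedRay_integral_eq_zero [CompleteSpace E] {ι : Type*}
    [Fintype ι] (b : OrthonormalBasis ι ℝ E)
    {R k : ℝ} (hR : 0 < R) {a f : E → ℝ} {α : E → E}
    (ha : ContDiff ℝ (⊤ : ℕ∞) a) (hf : ContDiff ℝ (⊤ : ℕ∞) f) (hα : ContDiff ℝ (⊤ : ℕ∞) α)
    (hf0 : ∀ x, R < ‖x‖ → f x = 0) (hα0 : ∀ x, R < ‖x‖ → α x = 0)
    (hak : ∀ x, |a x| < k) (hkR : k * R < Real.pi / 2)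
    (hvanish : ∀ x θ : E, ‖θ‖ = 1 →
      (∫ t : ℝ, (f (x + t • θ) + ⟪α (x + t • θ), θ⟫) *
        Real.exp (∫ s in (0 : ℝ)..t, a (x + s • θ))) = 0)
    {i₀ i₁ : ι} (hne : i₀ ≠ i₁) :
    ∃ p : E → ℝ, ContDiff ℝ (⊤ : ℕ∞) p ∧ (∀ x, ‖x‖ = R → p x = 0) ∧
      ∀ x, f x = a x * p x ∧ α x = gradient p x := by
  have hdir := attenuatedRay_eq_of_orthonormal b.orthonormal hR ha hf hα hf0 hα0 hak hkR
    hvanish hne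
  obtain ⟨U, hU⟩ : ∃ U : E → ℝ,
      ∀ y, attenuatedRay R a f α y (b i₀) = U y := ⟨_, fun _ => rfl⟩
  have hUs : ContDiff ℝ (⊤ : ℕ∞) U := by
    rw [← funext hU]
    exact (contDiff_attenuatedRay R ha hf hα).comp (contDiff_id.prodMk contDiff_const)
  simp only [hU] at hdir
  have key := fun i => eq_mul_and_inner_eq_fderiv ha.continuous hf.continuous hα.continuous hUs
    (b.norm_eq_one i) (fun y => (hdir i y).1) (fun y => (hdir i y).2)
  refine ⟨fun y => -U y, hUs.neg, fun x hx => ?_, fun x => ⟨?_, ?_⟩⟩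
  · rw [neg_eq_zero]
    refine eq_zero_of_le_norm hUs.continuous hR.ne' (fun y hy => ?_) hx.ge
    rw [← hU]
    exact attenuatedRay_eq_zero hR.le hf0 hα0 (b.norm_eq_one i₀) (hvanish y _ (b.norm_eq_one i₀)) hy
  · rw [(key i₀ x).1, mul_neg]
  · refine InnerProductSpace.ext_inner_right_basis b.toBasis fun i => ?_
    rw [b.coe_toBasis, (key i x).2, gradient, InnerProductSpace.toDual_symm_apply,
      fderiv_fun_neg]
    rfl

end

theorem statement18 {n : ℕ} (hn : 2 ≤ n) (R : ℝ) (hR : 0 < R)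
    (a f : EuclideanSpace ℝ (Fin n) → ℝ)
    (α : EuclideanSpace ℝ (Fin n) → EuclideanSpace ℝ (Fin n))
    (ha : ContDiff ℝ (⊤ : ℕ∞) a) (hf : ContDiff ℝ (⊤ : ℕ∞) f)
    (hα : ContDiff ℝ (⊤ : ℕ∞) α)
    (hsa : tsupport a ⊆ Metric.closedBall 0 R)
    (hsf : tsupport f ⊆ Metric.closedBall 0 R)
    (hsα : tsupport α ⊆ Metric.closedBall 0 R)
    (hsmall : ∀ x, |a x| < Real.pi / (2 * R))
    (hvanish : ∀ x θ : EuclideanSpace ℝ (Fin n), ‖θ‖ = 1 →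
      (∫ t : ℝ, (f (x + t • θ) + ⟪α (x + t • θ), θ⟫) *
        Real.exp (∫ s in (0 : ℝ)..t, a (x + s • θ))) = 0) :
    ∃ p : EuclideanSpace ℝ (Fin n) → ℝ, ContDiff ℝ (⊤ : ℕ∞) p ∧
      (∀ x, ‖x‖ = R → p x = 0) ∧
      ∀ x ∈ Metric.ball (0 : EuclideanSpace ℝ (Fin n)) R,
        f x = a x * p x ∧ α x = gradient p x := by
  obtain ⟨k, hak, hkR⟩ := exists_bound_of_tsupport_subset hR ha.continuous hsa hsmall
  have hne : (⟨0, by omega⟩ : Fin n) ≠ ⟨1, by omega⟩ := by simp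
  obtain ⟨p, hp, hp0, hpx⟩ := exists_gradient_of_attenuatedRay_integral_eq_zero
    (EuclideanSpace.basisFun (Fin n) ℝ) hR ha hf hα
    (fun x => eq_zero_of_tsupport_subset_closedBall hsf)
    (fun x => eq_zero_of_tsupport_subset_closedBall hsα) hak hkR hvanish hne
  exact ⟨p, hp, hp0, fun x _ => hpx x⟩
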